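/- Let a > 0 and 0 ≤ |b| < a. For ε > 0 let k = ⌊√(a² − b²)/(2 a² π ε)⌋, and let m ≥ 1 be an integer with k ≥ m. If ε ≤ √(a² − b²)/(4 π a² m), then 1 − b²/a² − 4 a² (k − m)² ε² π² ≥ π m ε √(a² − b²). -/

import Mathlib

open Set Real

/-- Lower bound on the discriminant for the modes `n = k − m`, where
`k = ⌊√(a² − b²)/(2a²πε)⌋`: if `ε ≤ √(a² − b²)/(4πa²m)` then
`1 − b²/a² − 4a²(k − m)²ε²π² ≥ πmε√(a² − b²)`. -/
theorem discriminant_lower_bound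
    (a b ε : ℝ) (ha : 0 < a) (hba : |b| < a) (hε : 0 < ε)
    (m : ℕ) (hm : 1 ≤ m)
    (k : ℕ) (hk : k = ⌊Real.sqrt (a ^ 2 - b ^ 2) / (2 * a ^ 2 * π * ε)⌋₊)
    (hkm : m ≤ k)
    (hεm : ε ≤ Real.sqrt (a ^ 2 - b ^ 2) / (4 * π * a ^ 2 * m)) :
    1 - b ^ 2 / a ^ 2 - 4 * a ^ 2 * ((k : ℝ) - m) ^ 2 * ε ^ 2 * π ^ 2
      ≥ π * m * ε * Real.sqrt (a ^ 2 - b ^ 2) := by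
  have hab : b ^ 2 < a ^ 2 := by
    rw [← sq_abs b]
    gcongr
  have hs_sq : Real.sqrt (a ^ 2 - b ^ 2) ^ 2 = a ^ 2 - b ^ 2 := Real.sq_sqrt (by linarith)
  set s := Real.sqrt (a ^ 2 - b ^ 2)
  have hs : 0 ≤ s := Real.sqrt_nonneg _
  have hπ := Real.pi_pos
  have hm_pos : (0 : ℝ) < m := by exact_mod_cast hm
  have hkm' : (m : ℝ) ≤ k := by exact_mod_cast hkm
  have hk_le : (k : ℝ) * (2 * a ^ 2 * π * ε) ≤ s := by
    rw [← le_div_iff₀ (by positivity), hk]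
    exact Nat.floor_le (by positivity)
  have hm_le : ε * (4 * π * a ^ 2 * m) ≤ s := (le_div_iff₀ (by positivity)).1 hεm
  have hsq : (2 * a ^ 2 * π * ε * ((k : ℝ) - m)) ^ 2 ≤ (s - 2 * a ^ 2 * π * ε * m) ^ 2 := by
    have hj : 0 ≤ (k : ℝ) - m := by linarith
    exact pow_le_pow_left₀ (by positivity) (by linarith) 2
  have hcross : 0 ≤ (2 * a ^ 2 * π * ε * m) * (3 * s / 2 - 2 * a ^ 2 * π * ε * m) :=
    mul_nonneg (by positivity) (by linarith)
  have hdisc : 1 - b ^ 2 / a ^ 2 - 4 * a ^ 2 * ((k : ℝ) - m) ^ 2 * ε ^ 2 * π ^ 2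
      = (s ^ 2 - (2 * a ^ 2 * π * ε * ((k : ℝ) - m)) ^ 2) / a ^ 2 := by
    rw [hs_sq]
    field_simp
    ring
  rw [ge_iff_le, hdisc, le_div_iff₀ (by positivity)]
  linarith
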